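/- For all integers t ≥ 1 and k ≥ 4, the maximum cardinality of a partial k-spread in 𝔽_2^{k(t+1)+2} equals (2^{k(t+1)+2} − 3·2^k − 1)/(2^k − 1); that is, every partial k-spread in 𝔽_2^{k(t+1)+2} has at most this many members, and a partial k-spread of exactly this size exists. -/

import Mathlib

/-- A partial `k`-spread in `𝔽_2^n`: a set of `k`-dimensional subspaces
any two distinct members of which intersect trivially. -/
def IsPartialSpread {n : ℕ} (k : ℕ)
    (S : Finset (Submodule (ZMod 2) (Fin n → ZMod 2))) : Prop :=
  (∀ U ∈ S, Module.finrank (ZMod 2) U = k) ∧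
  ∀ U ∈ S, ∀ V ∈ S, U ≠ V → U ⊓ V = ⊥

/-- The size of the standard construction. -/
def spreadSize (k : ℕ) : ℕ → ℕ
  | 0 => 1
  | t + 1 => spreadSize k t + 2 ^ (k * (t + 1) + 2)

theorem spreadSize_mul (k t : ℕ) :
    spreadSize k t * (2 ^ k - 1) + (3 * 2 ^ k + 1) = 2 ^ (k * (t + 1) + 2) := by
  obtain ⟨x, hx⟩ : ∃ x, 2 ^ k = x + 1 := ⟨2 ^ k - 1, by have := Nat.one_le_two_pow (n := k); omega⟩
  induction t with
  | zero =>
    simp only [spreadSize, zero_add, mul_one, pow_add, hx]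
    simp; ring
  | succ t ih =>
    have h2 : 2 ^ (k * (t + 1 + 1) + 2) = 2 ^ (k * (t + 1) + 2) * 2 ^ k := by
      rw [← pow_add]; congr 1; ring
    rw [h2, spreadSize]
    rw [hx] at ih ⊢
    simp only [Nat.add_sub_cancel] at ih ⊢
    generalize 2 ^ (k * (t + 1) + 2) = y at *
    subst ih; ring

theorem spreadSize_eq (k t : ℕ) (hk : 1 ≤ k) :
    (2 ^ (k * (t + 1) + 2) - 3 * 2 ^ k - 1) / (2 ^ k - 1) = spreadSize k t := by
  rw [← spreadSize_mul]
  have h1 : 2 ^ 1 ≤ 2 ^ k := Nat.pow_le_pow_right (by norm_num) hk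
  rw [Nat.sub_sub, Nat.add_sub_cancel]
  exact Nat.mul_div_cancel _ (by omega)

theorem spreadSize_mod (k t : ℕ) : ∃ s, spreadSize k t = 2 ^ k * s + 1 := by
  induction t with
  | zero => exact ⟨0, rfl⟩
  | succ t ih =>
    obtain ⟨s, hs⟩ := ih
    refine ⟨s + 2 ^ (k * t + 2), ?_⟩
    rw [spreadSize, hs, show k * (t + 1) + 2 = k + (k * t + 2) by ring, pow_add]
    ring

theorem exists_inj {X Y : Type} [AddCommGroup X] [AddCommGroup Y] [Module (ZMod 2) X]
    [Module (ZMod 2) Y] [FiniteDimensional (ZMod 2) X] [FiniteDimensional (ZMod 2) Y]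
    (h : Module.finrank (ZMod 2) X ≤ Module.finrank (ZMod 2) Y) :
    ∃ φ : X →ₗ[ZMod 2] Y, Function.Injective φ :=
  finrank_le_iff_exists_linearMap.1 h

/-- Indexed families of pairwise disjoint `k`-subspaces. -/
theorem exists_family (k t : ℕ) (hk : 1 ≤ k) :
    ∃ (ι : Type) (_ : Fintype ι)
      (U : ι → Submodule (ZMod 2) (Fin (k * (t + 1) + 2) → ZMod 2)),
      Fintype.card ι = spreadSize k t ∧ (∀ i, Module.finrank (ZMod 2) (U i) = k) ∧
      ∀ i j, i ≠ j → U i ⊓ U j = ⊥ := by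
  induction t with
  | zero =>
    obtain ⟨W, hW⟩ : ∃ W : Submodule (ZMod 2) (Fin (k * (0 + 1) + 2) → ZMod 2),
        Module.finrank (ZMod 2) W = k := by
      obtain ⟨φ, hφ⟩ := exists_inj (X := Fin k → ZMod 2) (Y := Fin (k * (0 + 1) + 2) → ZMod 2) (by
        rw [Module.finrank_fin_fun, Module.finrank_fin_fun]; omega)
      exact ⟨LinearMap.range φ, by rw [LinearMap.finrank_range_of_inj hφ, Module.finrank_fin_fun]⟩
    exact ⟨Unit, inferInstance, fun _ => W, rfl, fun _ => hW, fun i j h => (h rfl).elim⟩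
  | succ t ih =>
    set n := k * (t + 1) + 2 with hn
    obtain ⟨ι, _, U, hc, hd, hU⟩ := ih
    have hn0 : n ≠ 0 := by omega
    let L := GaloisField 2 n
    have : Fintype L := Fintype.ofFinite L
    have hL : Module.finrank (ZMod 2) L = n := GaloisField.finrank 2 hn0
    have hcL : Fintype.card L = 2 ^ n := by
      rw [← Nat.card_eq_fintype_card]; exact GaloisField.card 2 n hn0
    have hkn : k ≤ n := by rw [hn, mul_add]; nlinarith [Nat.zero_le (k * t)]
    obtain ⟨φ, hφ⟩ := exists_inj (X := Fin k → ZMod 2) (Y := L) (by rw [hL]; simpa using hkn)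
    let e : (Fin n → ZMod 2) ≃ₗ[ZMod 2] L :=
      LinearEquiv.ofFinrankEq _ _ (by rw [hL]; simp)
    let E : ((Fin k → ZMod 2) × L) ≃ₗ[ZMod 2] (Fin (k * (t + 1 + 1) + 2) → ZMod 2) :=
      LinearEquiv.ofFinrankEq _ _ (by
        rw [Module.finrank_prod, hL]; simp [hn]; ring)
    let g : L → ((Fin k → ZMod 2) →ₗ[ZMod 2] ((Fin k → ZMod 2) × L)) := fun a =>
      LinearMap.prod LinearMap.id ((LinearMap.mulLeft (ZMod 2) a).comp φ)
    have hg : ∀ a x, g a x = (x, a * φ x) := fun a x => rfl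
    let h : (Fin n → ZMod 2) →ₗ[ZMod 2] ((Fin k → ZMod 2) × L) :=
      (LinearMap.inr (ZMod 2) (Fin k → ZMod 2) L).comp e.toLinearMap
    have hh : ∀ x, h x = (0, e x) := fun x => rfl
    let T : L ⊕ ι → Submodule (ZMod 2) ((Fin k → ZMod 2) × L) :=
      Sum.elim (fun a => LinearMap.range (g a)) (fun i => (U i).map h)
    have hinj : Function.Injective h := by
      intro x y hxy
      rw [hh, hh, Prod.mk.injEq] at hxy
      exact e.injective hxy.2
    have hTd : ∀ i, Module.finrank (ZMod 2) (T i) = k := by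
      rintro (a | i)
      · change Module.finrank (ZMod 2) (LinearMap.range (g a)) = k
        rw [LinearMap.finrank_range_of_inj]
        · simp
        · intro x y hxy
          rw [hg, hg, Prod.mk.injEq] at hxy
          exact hxy.1
      · change Module.finrank (ZMod 2) ((U i).map h) = k
        exact (LinearEquiv.finrank_eq (Submodule.equivMapOfInjective h hinj (U i))).symm.trans (hd i)
    have hdis : ∀ i j, i ≠ j → ∀ v, v ∈ T i → v ∈ T j → v = 0 := by
      rintro (a | i) (b | j) hij v hv hw
      · obtain ⟨x, rfl⟩ := hv
        obtain ⟨y, hy⟩ := hw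
        rw [hg, hg, Prod.mk.injEq] at hy
        obtain ⟨rfl, hy⟩ := hy
        have hab : a ≠ b := fun h => hij (by rw [h])
        have : (b - a) * φ y = 0 := by rw [sub_mul, hy, sub_self]
        rcases mul_eq_zero.1 this with h0 | h0
        · exact (hab (sub_eq_zero.1 h0).symm).elim
        · have : y = 0 := hφ (by rw [h0, map_zero])
          rw [this, map_zero]
      · obtain ⟨x, rfl⟩ := hv
        obtain ⟨y, -, hy⟩ := hw
        rw [hg, hh, Prod.mk.injEq] at hy
        rw [← hy.1, map_zero]
      · obtain ⟨x, rfl⟩ := hw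
        obtain ⟨y, -, hy⟩ := hv
        rw [hg, hh, Prod.mk.injEq] at hy
        rw [← hy.1, map_zero]
      · obtain ⟨x, hx, rfl⟩ := hv
        obtain ⟨y, hy, hxy⟩ := hw
        have := hinj hxy
        subst this
        have hm : y ∈ U i ⊓ U j := ⟨hx, hy⟩
        rw [hU i j (fun h => hij (by rw [h])), Submodule.mem_bot] at hm
        rw [hm, map_zero]
    refine ⟨L ⊕ ι, inferInstance, fun i => (T i).map E.toLinearMap, ?_, ?_, ?_⟩
    · rw [Fintype.card_sum, hcL, hc, spreadSize, add_comm]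
    · intro i
      exact (LinearEquiv.finrank_eq (Submodule.equivMapOfInjective E.toLinearMap E.injective (T i))).symm.trans (hTd i)
    · intro i j hij
      rw [eq_bot_iff]
      rintro v ⟨⟨x, hx, rfl⟩, ⟨y, hy, hxy⟩⟩
      have : y = x := E.injective hxy
      subst this
      rw [hdis i j hij y hx hy, map_zero]
      exact Submodule.zero_mem _

theorem exists_spread (k t : ℕ) (hk : 1 ≤ k) :
    ∃ S : Finset (Submodule (ZMod 2) (Fin (k * (t + 1) + 2) → ZMod 2)),
      IsPartialSpread k S ∧ S.card = spreadSize k t := by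
  classical
  obtain ⟨ι, _, U, hc, hd, hU⟩ := exists_family k t hk
  have hinj : Function.Injective U := by
    intro i j hij
    by_contra hne
    have h1 := hU i j hne
    rw [← hij, inf_idem] at h1
    have h2 := hd i
    rw [h1, finrank_bot] at h2
    omega
  refine ⟨Finset.univ.image U, ⟨?_, ?_⟩, ?_⟩
  · intro W hW
    obtain ⟨i, -, rfl⟩ := Finset.mem_image.1 hW
    exact hd i
  · intro W hW W' hW' hne
    obtain ⟨i, -, rfl⟩ := Finset.mem_image.1 hW
    obtain ⟨j, -, rfl⟩ := Finset.mem_image.1 hW'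
    exact hU i j (fun h => hne (by rw [h]))
  · rw [Finset.card_image_of_injective _ hinj, Finset.card_univ, hc]

/-- Averaging: some functional vanishes on at most half of the nonzero vectors of `Q`. -/
theorem exists_functional {n : ℕ} (Q : Finset (Fin n → ZMod 2)) (hQ : ∀ q ∈ Q, q ≠ 0) :
    ∃ f : (Fin n → ZMod 2) →ₗ[ZMod 2] ZMod 2, 2 * (Q.filter (fun q => f q = 0)).card ≤ Q.card := by
  classical
  have : Finite ((Fin n → ZMod 2) →ₗ[ZMod 2] ZMod 2) := Module.finite_of_finite (ZMod 2)
  have : Fintype ((Fin n → ZMod 2) →ₗ[ZMod 2] ZMod 2) := Fintype.ofFinite _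
  by_contra! hcon
  have key : ∀ q ∈ Q, 2 * (Finset.univ.filter
      (fun f : (Fin n → ZMod 2) →ₗ[ZMod 2] ZMod 2 => f q = 0)).card =
      Fintype.card ((Fin n → ZMod 2) →ₗ[ZMod 2] ZMod 2) := by
    intro q hq
    obtain ⟨i, hi⟩ := Function.ne_iff.1 (hQ q hq)
    have h01 : ∀ x : ZMod 2, x ≠ 0 → x = 1 := by decide
    have h011 : ∀ x : ZMod 2, x + 1 = 0 ↔ ¬ x = 0 := by decide
    have hi1 : q i = 1 := h01 _ hi
    have h1 := Finset.card_filter_add_card_filter_not (s := Finset.univ)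
      (fun f : (Fin n → ZMod 2) →ₗ[ZMod 2] ZMod 2 => f q = 0)
    have h2 : (Finset.univ.filter
        (fun f : (Fin n → ZMod 2) →ₗ[ZMod 2] ZMod 2 => ¬ f q = 0)).card =
        (Finset.univ.filter (fun f : (Fin n → ZMod 2) →ₗ[ZMod 2] ZMod 2 => f q = 0)).card := by
      refine Finset.card_equiv (Equiv.addRight (LinearMap.proj i)) ?_
      intro f
      simp [hi1, h011]
    rw [h2, Finset.card_univ] at h1
    omega
  have hsum : ∑ f : (Fin n → ZMod 2) →ₗ[ZMod 2] ZMod 2, 2 * (Q.filter (fun q => f q = 0)).card =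
      ∑ f : (Fin n → ZMod 2) →ₗ[ZMod 2] ZMod 2, Q.card := by
    rw [← Finset.mul_sum]
    simp_rw [Finset.card_filter]
    rw [Finset.sum_comm, Finset.mul_sum]
    simp_rw [← Finset.card_filter]
    rw [Finset.sum_congr rfl key]
    simp [mul_comm]
  have := Finset.sum_lt_sum_of_nonempty (s := Finset.univ) Finset.univ_nonempty
    (fun f _ => hcon f)
  omega

open Classical in
/-- The holes of a family of subspaces inside `W`. -/
noncomputable def holes {n : ℕ} (S : Finset (Submodule (ZMod 2) (Fin n → ZMod 2)))
    (W : Submodule (ZMod 2) (Fin n → ZMod 2)) : Finset (Fin n → ZMod 2) :=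
  Finset.univ.filter (fun v => v ∈ W ∧ v ≠ 0 ∧ ∀ U ∈ S, v ∉ U)

open Classical in
theorem card_nonzero {n : ℕ} (W : Submodule (ZMod 2) (Fin n → ZMod 2)) :
    (Finset.univ.filter (fun v => v ∈ W ∧ v ≠ 0)).card + 1 = 2 ^ Module.finrank (ZMod 2) W := by
  have h1 : Nat.card W = 2 ^ Module.finrank (ZMod 2) W := by
    have := Module.natCard_eq_pow_finrank (K := ZMod 2) (V := W)
    simpa using this
  rw [← h1]
  have h2 : Nat.card W = (Finset.univ.filter (fun v => v ∈ W)).card := by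
    rw [Nat.card_eq_fintype_card, Fintype.card_subtype]
  rw [h2, ← Finset.card_erase_add_one (a := 0) (s := Finset.univ.filter (fun v => v ∈ W)) (by simp)]
  congr 2
  ext v
  simp [and_comm]

theorem card_holes {n k : ℕ} {S : Finset (Submodule (ZMod 2) (Fin n → ZMod 2))}
    (hS : IsPartialSpread k S) (W : Submodule (ZMod 2) (Fin n → ZMod 2)) :
    (holes S W).card + 1 + ∑ U ∈ S, (2 ^ Module.finrank (ZMod 2) ↥(U ⊓ W) - 1) =
      2 ^ Module.finrank (ZMod 2) W := by
  classical
  rw [← card_nonzero W]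
  have h1 : ∑ U ∈ S, (2 ^ Module.finrank (ZMod 2) ↥(U ⊓ W) - 1) =
      (S.biUnion fun U => Finset.univ.filter (fun v => v ∈ U ⊓ W ∧ v ≠ 0)).card := by
    rw [Finset.card_biUnion]
    · refine Finset.sum_congr rfl fun U _ => ?_
      rw [← card_nonzero (U ⊓ W), Nat.add_sub_cancel]
    · intro U hU U' hU' hne
      refine Finset.disjoint_left.2 ?_
      intro v hv hv'
      simp only [Finset.mem_filter, Submodule.mem_inf] at hv hv'
      have hm : v ∈ U ⊓ U' := ⟨hv.2.1.1, hv'.2.1.1⟩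
      rw [hS.2 U hU U' hU' hne, Submodule.mem_bot] at hm
      exact hv.2.2 hm
  rw [h1, add_right_comm, ← Finset.card_union_of_disjoint]
  · congr 2
    ext v
    simp only [holes, Finset.mem_union, Finset.mem_filter, Finset.mem_univ, true_and,
      Finset.mem_biUnion, Submodule.mem_inf]
    constructor
    · rintro (h | ⟨U, hU, h⟩)
      · exact ⟨h.1, h.2.1⟩
      · exact ⟨h.1.2, h.2⟩
    · rintro ⟨hW, h0⟩
      by_cases hv : ∃ U ∈ S, v ∈ U
      · obtain ⟨U, hU, hvU⟩ := hv
        exact Or.inr ⟨U, hU, ⟨hvU, hW⟩, h0⟩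
      · push Not at hv
        exact Or.inl ⟨hW, h0, hv⟩
  · rw [Finset.disjoint_left]
    intro v hv hv'
    simp only [holes, Finset.mem_filter, Finset.mem_univ, true_and,
      Finset.mem_biUnion, Submodule.mem_inf] at hv hv'
    obtain ⟨U, hU, h⟩ := hv'
    exact hv.2.2 U hU h.1.1

theorem holes_mod {n k j : ℕ} {S : Finset (Submodule (ZMod 2) (Fin n → ZMod 2))}
    (hS : IsPartialSpread k S) (W : Submodule (ZMod 2) (Fin n → ZMod 2))
    (hW : n ≤ Module.finrank (ZMod 2) W + j) (hkn : k ≤ n) :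
    (holes S W).card + 1 ≡ S.card [MOD 2 ^ (k - j)] := by
  have h := card_holes hS W
  have hsum : ∑ U ∈ S, (2 ^ Module.finrank (ZMod 2) ↥(U ⊓ W) - 1) + S.card =
      ∑ U ∈ S, 2 ^ Module.finrank (ZMod 2) ↥(U ⊓ W) := by
    rw [Finset.card_eq_sum_ones, ← Finset.sum_add_distrib]
    refine Finset.sum_congr rfl fun U _ => ?_
    exact Nat.sub_add_cancel Nat.one_le_two_pow
  have hdvd : 2 ^ (k - j) ∣ ∑ U ∈ S, 2 ^ Module.finrank (ZMod 2) ↥(U ⊓ W) := by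
    refine Finset.dvd_sum fun U hU => pow_dvd_pow _ ?_
    have h1 := Submodule.finrank_sup_add_finrank_inf_eq U W
    have h2 := Submodule.finrank_le (U ⊔ W)
    rw [Module.finrank_fin_fun] at h2
    have h3 := hS.1 U hU
    omega
  have hdvd2 : 2 ^ (k - j) ∣ 2 ^ Module.finrank (ZMod 2) W := pow_dvd_pow _ (by omega)
  obtain ⟨a, ha⟩ := hdvd
  obtain ⟨b, hb⟩ := hdvd2
  rw [ha] at hsum
  rw [hb] at h
  have h4 : (holes S W).card + 1 + 2 ^ (k - j) * a = S.card + 2 ^ (k - j) * b := by omega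
  have h5 : ((holes S W).card + 1 + 2 ^ (k - j) * a) % 2 ^ (k - j) =
      (S.card + 2 ^ (k - j) * b) % 2 ^ (k - j) := by rw [h4]
  rwa [Nat.add_mul_mod_self_left, Nat.add_mul_mod_self_left] at h5

theorem exists_hyperplane {n j : ℕ} (S : Finset (Submodule (ZMod 2) (Fin n → ZMod 2)))
    (W : Submodule (ZMod 2) (Fin n → ZMod 2)) (hW : n ≤ Module.finrank (ZMod 2) W + j) :
    ∃ W' : Submodule (ZMod 2) (Fin n → ZMod 2), n ≤ Module.finrank (ZMod 2) W' + (j + 1) ∧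
      2 * (holes S W').card ≤ (holes S W).card := by
  classical
  obtain ⟨f, hf⟩ := exists_functional (holes S W) (fun q hq => by
    simp only [holes, Finset.mem_filter] at hq; exact hq.2.2.1)
  refine ⟨W ⊓ LinearMap.ker f, ?_, ?_⟩
  · have h1 := Submodule.finrank_sup_add_finrank_inf_eq W (LinearMap.ker f)
    have h2 := Submodule.finrank_le (W ⊔ LinearMap.ker f)
    have h3 := LinearMap.finrank_range_add_finrank_ker f
    have h4 := Submodule.finrank_le (LinearMap.range f)
    rw [Module.finrank_self] at h4
    rw [Module.finrank_fin_fun] at h2 h3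
    omega
  · convert hf using 3
    ext v
    simp only [holes, Finset.mem_filter, Finset.mem_univ, true_and, Submodule.mem_inf,
      LinearMap.mem_ker]
    tauto

theorem no_large_spread (k t : ℕ) (hk : 4 ≤ k)
    (S : Finset (Submodule (ZMod 2) (Fin (k * (t + 1) + 2) → ZMod 2)))
    (hS : IsPartialSpread k S) (hc : S.card = spreadSize k t + 1) : False := by
  have hkn : k ≤ k * (t + 1) + 2 := by nlinarith [Nat.zero_le (k * t)]
  have hmod : ∀ j, j ≤ k → ∀ W : Submodule (ZMod 2) (Fin (k * (t + 1) + 2) → ZMod 2),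
      k * (t + 1) + 2 ≤ Module.finrank (ZMod 2) W + j →
      (holes S W).card ≡ 1 [MOD 2 ^ (k - j)] := by
    intro j hj W hW
    have h := holes_mod hS W hW hkn
    rw [hc] at h
    have h' : (holes S W).card ≡ spreadSize k t [MOD 2 ^ (k - j)] := Nat.ModEq.add_right_cancel' 1 h
    refine h'.trans ?_
    obtain ⟨s, hs⟩ := spreadSize_mod k t
    have : spreadSize k t = 2 ^ (k - j) * (2 ^ j * s) + 1 := by
      rw [hs, ← mul_assoc, ← pow_add, Nat.sub_add_cancel hj]
    rw [this]
    unfold Nat.ModEq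
    rw [add_comm, Nat.add_mul_mod_self_left]
  have htop : Module.finrank (ZMod 2) (⊤ : Submodule (ZMod 2) (Fin (k * (t + 1) + 2) → ZMod 2))
      = k * (t + 1) + 2 := by rw [finrank_top, Module.finrank_fin_fun]
  -- total number of holes
  have h0 : (holes S ⊤).card = 2 ^ (k + 1) + 1 := by
    have h := card_holes hS ⊤
    have hs : ∑ U ∈ S, (2 ^ Module.finrank (ZMod 2) ↥(U ⊓ ⊤) - 1) = S.card * (2 ^ k - 1) := by
      rw [Finset.sum_congr rfl (g := fun _ => 2 ^ k - 1), Finset.sum_const, smul_eq_mul]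
      intro U hU
      rw [inf_top_eq, hS.1 U hU]
    rw [hs, htop, ← spreadSize_mul, hc, add_mul, one_mul] at h
    have := Nat.one_le_two_pow (n := k)
    rw [pow_succ]
    omega
  obtain ⟨W1, hW1, hc1⟩ := exists_hyperplane (j := 0) S ⊤ (by rw [htop])
  obtain ⟨W2, hW2, hc2⟩ := exists_hyperplane S W1 hW1
  obtain ⟨W3, hW3, hc3⟩ := exists_hyperplane S W2 hW2
  have m1 := hmod 1 (by omega) W1 hW1
  have m2 := hmod 2 (by omega) W2 hW2
  have m3 := hmod 3 (by omega) W3 hW3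
  obtain ⟨d, rfl⟩ : ∃ d, k = d + 4 := ⟨k - 4, by omega⟩
  have e1 : 2 ^ (d + 4 - 1) = 8 * 2 ^ d := by rw [show d + 4 - 1 = d + 3 by omega, pow_add]; ring
  have e2 : 2 ^ (d + 4 - 2) = 4 * 2 ^ d := by rw [show d + 4 - 2 = d + 2 by omega, pow_add]; ring
  have e3 : 2 ^ (d + 4 - 3) = 2 * 2 ^ d := by rw [show d + 4 - 3 = d + 1 by omega, pow_add]; ring
  have e0 : 2 ^ (d + 4 + 1) = 32 * 2 ^ d := by rw [show d + 4 + 1 = d + 5 by omega, pow_add]; ring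
  rw [e1] at m1
  rw [e2] at m2
  rw [e3] at m3
  rw [e0] at h0
  have hp := Nat.one_le_two_pow (n := d)
  generalize 2 ^ d = x at *
  have step : ∀ {c y : ℕ}, 2 ≤ y → c ≡ 1 [MOD y] → ∃ a, c = y * a + 1 := by
    intro c y hy h
    refine ⟨c / y, ?_⟩
    have h' : c % y = 1 := by
      rw [h, Nat.mod_eq_of_lt (by omega)]
    rw [← h', Nat.div_add_mod]
  obtain ⟨a1, ha1⟩ := step (by omega) m1
  obtain ⟨a2, ha2⟩ := step (by omega) m2
  obtain ⟨a3, ha3⟩ := step (by omega) m3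
  have b1 : a1 < 2 := by
    by_contra! hb
    have := Nat.mul_le_mul_left (8 * x) hb
    omega
  have b1' : 8 * x * a1 ≤ 8 * x := by
    have := Nat.mul_le_mul_left (8 * x) (Nat.lt_succ_iff.1 b1)
    omega
  have b2 : a2 = 0 := by
    by_contra hb
    have := Nat.mul_le_mul_left (4 * x) (Nat.one_le_iff_ne_zero.2 hb)
    omega
  subst b2
  omega

/-- Main theorem: for `t ≥ 1` and `k ≥ 4`, the maximum size of a partial
`k`-spread in `𝔽_2^{k(t+1)+2}` equals `(2^{k(t+1)+2} − 3·2^k − 1)/(2^k − 1)`. -/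
theorem partial_spread_max_mod_two (t k : ℕ) (ht : 1 ≤ t) (hk : 4 ≤ k) :
    IsGreatest {c : ℕ | ∃ S : Finset (Submodule (ZMod 2) (Fin (k * (t + 1) + 2) → ZMod 2)),
        IsPartialSpread k S ∧ S.card = c}
      ((2 ^ (k * (t + 1) + 2) - 3 * 2 ^ k - 1) / (2 ^ k - 1)) := by
  rw [spreadSize_eq k t (by omega)]
  refine ⟨exists_spread k t (by omega), ?_⟩
  rintro c ⟨S, hS, rfl⟩
  by_contra! hlt
  obtain ⟨S', hS', hc⟩ := Finset.exists_subset_card_eq (s := S) (n := spreadSize k t + 1) hlt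
  exact no_large_spread k t hk S'
    ⟨fun U hU => hS.1 U (hS' hU), fun U hU V hV => hS.2 U (hS' hU) V (hS' hV)⟩ hc
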